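/- For all integers p, q ≥ 1 and signs σ1, σ2 ∈ {1,−1} with (q,σ2) ≠ (1,1), the linear Euler S̃-sum S̃_{p,q}^{σ1,σ2}, viewed as a complex number, satisfies S̃_{p,q}^{σ1,σ2} = 2^{p+q−2} · σ2 · i^{3λ_{σ1}} · ( L_4(q,p; λ_{σ2}, λ_{σ1}) − L_4(q,p; λ_{σ2}, λ_{σ1}+2) + L_4(q,p; λ_{σ2}+2, λ_{σ1}) − L_4(q,p; λ_{σ2}+2, λ_{σ1}+2) ). -/

import Mathlib

open scoped BigOperators

/-- Alternating odd harmonic number `h_n^{(p)}(σ) = ∑_{k=1}^n σ^{k-1}/(k-1/2)^p`. -/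
noncomputable def oddH (n p : ℕ) (σ : ℝ) : ℝ :=
  ∑ k ∈ Finset.range n, σ ^ k / ((k : ℝ) + 1 / 2) ^ p

/-- Linear Euler S̃-sum `S̃_{p,q}^{σ1,σ2} = ∑_{n≥1} σ2^{n-1} h_n^{(p)}(σ1)/n^q`. -/
noncomputable def SSum (p q : ℕ) (σ1 σ2 : ℝ) : ℝ :=
  ∑' n : ℕ, σ2 ^ n * oddH (n + 1) p σ1 / ((n : ℝ) + 1) ^ q

/-- Depth-two colored multiple zeta value of level four
`L_4(s1,s2;r1,r2) = ∑_{n1>n2≥1} i^{r1 n1 + r2 n2}/(n1^{s1} n2^{s2})`. -/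
noncomputable def L4 (s1 s2 : ℕ) (r1 r2 : ℕ) : ℂ :=
  ∑' x : {p : ℕ × ℕ // 0 < p.2 ∧ p.2 < p.1},
    Complex.I ^ (r1 * x.1.1 + r2 * x.1.2) / ((x.1.1 : ℂ) ^ s1 * (x.1.2 : ℂ) ^ s2)

/-- `λ_σ = 0` if `σ = 1`, and `λ_σ = 1` if `σ = -1`. -/
noncomputable def lam (σ : ℝ) : ℕ := if σ = 1 then 0 else 1

lemma aux_oddH (p : ℕ) (hp : 1 ≤ p) (σ : ℝ) (h : σ = 1 ∨ σ = -1) (m : ℕ) :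
    2 ^ p - (2 / 3 : ℝ) ^ p ≤ oddH (2 * m + 2) p σ := by
  induction m with
  | zero =>
    have e : oddH (2 * 0 + 2) p σ = 2 ^ p + σ * (2 / 3 : ℝ) ^ p := by
      unfold oddH
      simp only [Nat.mul_zero, Nat.zero_add, Finset.sum_range_succ, Finset.sum_range_zero]
      have e1 : (((1 : ℕ) : ℝ) + 1 / 2) = (2 / 3)⁻¹ := by norm_num
      have e2 : (((0 : ℕ) : ℝ) + 1 / 2) = (2)⁻¹ := by norm_num
      rw [e1, e2, inv_pow, inv_pow]
      simp
    rw [e]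
    have : (0 : ℝ) < (2 / 3 : ℝ) ^ p := by positivity
    rcases h with rfl | rfl <;> linarith
  | succ m ih =>
    have e : oddH (2 * (m + 1) + 2) p σ = oddH (2 * m + 2) p σ
        + 1 / (((2 * m + 2 : ℕ) : ℝ) + 1 / 2) ^ p
        + σ * (1 / (((2 * m + 3 : ℕ) : ℝ) + 1 / 2) ^ p) := by
      unfold oddH
      rw [show 2 * (m + 1) + 2 = (2 * m + 2) + 1 + 1 by ring, Finset.sum_range_succ,
        Finset.sum_range_succ]
      have hs : σ ^ (2 * m + 2) = 1 := by
        rw [show 2 * m + 2 = 2 * (m + 1) by ring, pow_mul]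
        rcases h with rfl | rfl <;> simp
      rw [pow_succ σ (2 * m + 2), hs]
      ring
    rw [e]
    have h0 : 0 < 1 / (((2 * m + 3 : ℕ) : ℝ) + 1 / 2) ^ p := by positivity
    have h1 : 1 / (((2 * m + 3 : ℕ) : ℝ) + 1 / 2) ^ p
        ≤ 1 / (((2 * m + 2 : ℕ) : ℝ) + 1 / 2) ^ p := by
      apply one_div_le_one_div_of_le (by positivity)
      gcongr
      omega
    rcases h with rfl | rfl <;> linarith

lemma aux_SSum_one (p : ℕ) (hp : 1 ≤ p) (σ : ℝ) (h : σ = 1 ∨ σ = -1) :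
    SSum p 1 σ (-1) = 0 := by
  unfold SSum
  apply tsum_eq_zero_of_not_summable
  intro hs
  have hinj : Function.Injective (fun m : ℕ => 2 * m + 1) := fun a b hab => by
    simp only at hab; omega
  have h2 := (hs.comp_injective hinj).neg
  have hc : 0 < 2 ^ p - (2 / 3 : ℝ) ^ p := by
    have : (2 / 3 : ℝ) ^ p < 2 ^ p := by
      apply pow_lt_pow_left₀ <;> norm_num
      omega
    linarith
  set c := 2 ^ p - (2 / 3 : ℝ) ^ p with hcdef
  have h3 : Summable (fun m : ℕ => (c / 2) * (1 / ((m + 1 : ℕ) : ℝ))) := by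
    refine Summable.of_nonneg_of_le (fun m => by positivity) (fun m => ?_) h2
    simp only [Function.comp]
    have := aux_oddH p hp σ h m
    rw [pow_succ, pow_mul]
    have e : -((((-1 : ℝ) ^ 2) ^ m * -1) * oddH (2 * m + 1 + 1) p σ /
        (((2 * m + 1 : ℕ) : ℝ) + 1) ^ 1) = oddH (2 * m + 2) p σ / (2 * (m + 1)) := by
      push_cast
      simp
      ring
    rw [e]
    calc c / 2 * (1 / ((m + 1 : ℕ) : ℝ)) = c / (2 * (m + 1)) := by push_cast; field_simp
      _ ≤ _ := by gcongr
  rw [summable_mul_left_iff (by positivity)] at h3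
  exact Real.not_summable_one_div_natCast
    ((summable_nat_add_iff (f := fun n : ℕ => 1 / (n : ℝ)) 1).1 h3)

lemma aux_L4_one (p r1 r2 : ℕ) : L4 1 p r1 r2 = 0 := by
  unfold L4
  apply tsum_eq_zero_of_not_summable
  intro hs
  have hinj : Function.Injective
      (fun m : ℕ => (⟨(m + 2, 1), by simp⟩ : {p : ℕ × ℕ // 0 < p.2 ∧ p.2 < p.1})) :=
    fun a b hab => by simpa using hab
  have h2 := (hs.comp_injective hinj).norm
  have h3 : Summable (fun m : ℕ => 1 / ((m + 2 : ℕ) : ℝ)) := by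
    refine h2.congr (fun m => ?_)
    simp only [Function.comp, norm_div, norm_mul, norm_pow, Complex.norm_I, Complex.norm_natCast]
    simp
  exact Real.not_summable_one_div_natCast
    ((summable_nat_add_iff (f := fun n : ℕ => 1 / (n : ℝ)) 2).1 h3)

lemma aux_summable (p q r1 r2 : ℕ) (hp : 1 ≤ p) (hq : 2 ≤ q) :
    Summable (fun x : {p : ℕ × ℕ // 0 < p.2 ∧ p.2 < p.1} =>
      Complex.I ^ (r1 * x.1.1 + r2 * x.1.2) / ((x.1.1 : ℂ) ^ q * (x.1.2 : ℂ) ^ p)) := by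
  have h0 : Summable (fun n : ℕ => 1 / (n : ℝ) ^ (3 / 2 : ℝ)) :=
    Real.summable_one_div_nat_rpow.2 (by norm_num)
  have h1 := h0.mul_of_nonneg h0 (fun n => by positivity) (fun n => by positivity)
  have h2 := h1.comp_injective
    (Subtype.val_injective (p := fun p : ℕ × ℕ => 0 < p.2 ∧ p.2 < p.1))
  refine Summable.of_norm_bounded h2 ?_
  rintro ⟨⟨a, b⟩, hb, hab⟩
  simp only at hb hab
  simp only [Function.comp, norm_div, norm_mul, norm_pow, Complex.norm_I, Complex.norm_natCast,
    one_pow]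
  have hb1 : (1 : ℝ) ≤ b := by exact_mod_cast hb
  have hba : (b : ℝ) ≤ a := by exact_mod_cast hab.le
  have ha0 : (0 : ℝ) < a := by linarith
  have hb0 : (0 : ℝ) < b := by linarith
  rw [one_div_mul_one_div]
  apply one_div_le_one_div_of_le (by positivity)
  calc (a : ℝ) ^ (3 / 2 : ℝ) * (b : ℝ) ^ (3 / 2 : ℝ)
      = (a : ℝ) ^ (3 / 2 : ℝ) * ((b : ℝ) ^ (1 / 2 : ℝ) * b) := by
        rw [show (3 / 2 : ℝ) = 1 / 2 + 1 by norm_num, Real.rpow_add hb0, Real.rpow_one]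
    _ ≤ (a : ℝ) ^ (3 / 2 : ℝ) * ((a : ℝ) ^ (1 / 2 : ℝ) * b) := by gcongr
    _ = (a : ℝ) ^ 2 * (b : ℝ) ^ 1 := by
        rw [← mul_assoc, ← Real.rpow_add ha0, pow_one]
        norm_num
    _ ≤ _ := by
        gcongr <;> linarith

def auxMap (x : Σ n : ℕ, Fin (n + 1)) : {p : ℕ × ℕ // 0 < p.2 ∧ p.2 < p.1} :=
  ⟨(2 * x.1 + 2, 2 * x.2.1 + 1), by have := x.2.2; constructor <;> simp <;> omega⟩

lemma auxMap_inj : Function.Injective auxMap := by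
  rintro ⟨n, k⟩ ⟨m, l⟩ h
  simp only [auxMap, Subtype.mk.injEq, Prod.mk.injEq] at h
  obtain rfl : n = m := by omega
  congr 1
  ext
  omega

lemma auxI_lam (σ : ℝ) (h : σ = 1 ∨ σ = -1) : (Complex.I ^ lam σ) ^ 2 = (σ : ℂ) := by
  rcases h with rfl | rfl
  · simp [lam]
  · have : lam (-1) = 1 := by unfold lam; norm_num
    simp [this]

theorem stmt11 (p q : ℕ) (hp : 1 ≤ p) (hq : 1 ≤ q) (σ1 σ2 : ℝ)
    (h1 : σ1 = 1 ∨ σ1 = -1) (h2 : σ2 = 1 ∨ σ2 = -1)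
    (hne : ¬(q = 1 ∧ σ2 = 1)) :
    (SSum p q σ1 σ2 : ℂ) =
      2 ^ (p + q - 2) * (σ2 : ℂ) * Complex.I ^ (3 * lam σ1) *
        (L4 q p (lam σ2) (lam σ1) - L4 q p (lam σ2) (lam σ1 + 2)
          + L4 q p (lam σ2 + 2) (lam σ1) - L4 q p (lam σ2 + 2) (lam σ1 + 2)) := by
  by_cases hq1 : q = 1
  · subst hq1
    have : σ2 = -1 := by
      rcases h2 with h | h
      · exact absurd ⟨rfl, h⟩ hne
      · exact h
    subst this
    rw [aux_SSum_one p hp σ1 h1]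
    simp [aux_L4_one]
  have hq2 : 2 ≤ q := by omega
  have s1 := aux_summable p q (lam σ2) (lam σ1) hp hq2
  have s2 := aux_summable p q (lam σ2) (lam σ1 + 2) hp hq2
  have s3 := aux_summable p q (lam σ2 + 2) (lam σ1) hp hq2
  have s4 := aux_summable p q (lam σ2 + 2) (lam σ1 + 2) hp hq2
  have sg := ((s1.sub s2).add s3).sub s4
  unfold L4
  rw [← s1.tsum_sub s2, ← (s1.sub s2).tsum_add s3, ← ((s1.sub s2).add s3).tsum_sub s4]
  have key : ∀ x : {p : ℕ × ℕ // 0 < p.2 ∧ p.2 < p.1},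
      Complex.I ^ (lam σ2 * x.1.1 + lam σ1 * x.1.2) / ((x.1.1 : ℂ) ^ q * (x.1.2 : ℂ) ^ p)
      - Complex.I ^ (lam σ2 * x.1.1 + (lam σ1 + 2) * x.1.2) / ((x.1.1 : ℂ) ^ q * (x.1.2 : ℂ) ^ p)
      + Complex.I ^ ((lam σ2 + 2) * x.1.1 + lam σ1 * x.1.2) / ((x.1.1 : ℂ) ^ q * (x.1.2 : ℂ) ^ p)
      - Complex.I ^ ((lam σ2 + 2) * x.1.1 + (lam σ1 + 2) * x.1.2) /
        ((x.1.1 : ℂ) ^ q * (x.1.2 : ℂ) ^ p)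
      = (1 + (-1) ^ x.1.1) * (1 - (-1) ^ x.1.2) * ((Complex.I ^ lam σ2) ^ x.1.1 *
        (Complex.I ^ lam σ1) ^ x.1.2) / ((x.1.1 : ℂ) ^ q * (x.1.2 : ℂ) ^ p) := by
    intro x
    have hI : ∀ n : ℕ, Complex.I ^ (2 * n) = (-1) ^ n := fun n => by
      rw [pow_mul, Complex.I_sq]
    simp only [add_mul, pow_add, hI, pow_mul]
    ring
  simp only [key] at sg ⊢
  have hsupp : Function.support (fun x : {p : ℕ × ℕ // 0 < p.2 ∧ p.2 < p.1} =>
      (1 + (-1) ^ x.1.1) * (1 - (-1) ^ x.1.2) * ((Complex.I ^ lam σ2) ^ x.1.1 *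
        (Complex.I ^ lam σ1) ^ x.1.2) / ((x.1.1 : ℂ) ^ q * (x.1.2 : ℂ) ^ p))
        ⊆ Set.range auxMap := by
    rintro ⟨⟨a, b⟩, hb, hab⟩ hx
    simp only at hb hab
    rw [Function.mem_support] at hx
    rcases Nat.even_or_odd a with ha | ha
    · rcases Nat.even_or_odd b with hb' | hb'
      · exfalso; apply hx; simp [hb'.neg_one_pow]
      · obtain ⟨n, hn⟩ := ha
        obtain ⟨k, hk⟩ := hb'
        refine ⟨⟨n - 1, ⟨k, by omega⟩⟩, ?_⟩
        simp only [auxMap, Subtype.mk.injEq, Prod.mk.injEq]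
        omega
    · exfalso; apply hx; simp [ha.neg_one_pow]
  rw [← auxMap_inj.tsum_eq hsupp]
  have sm := sg.comp_injective auxMap_inj
  simp only [Function.comp_def] at sm
  rw [sm.tsum_sigma, ← tsum_mul_left]
  unfold SSum
  rw [Complex.ofReal_tsum]
  congr 1
  funext n
  rw [tsum_fintype, Finset.mul_sum]
  unfold oddH
  push_cast
  rw [Finset.sum_range, Finset.mul_sum, Finset.sum_div]
  refine Finset.sum_congr rfl fun k _ => ?_
  simp only [auxMap]
  have e1 : ((-1 : ℂ)) ^ (2 * n + 2) = 1 := (by use n + 1; ring : Even (2 * n + 2)).neg_one_pow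
  have e2 : ((-1 : ℂ)) ^ (2 * k.1 + 1) = -1 := Odd.neg_one_pow ⟨k.1, rfl⟩
  have e3 : (Complex.I ^ lam σ2) ^ (2 * n + 2) = (σ2 : ℂ) ^ (n + 1) := by
    rw [show 2 * n + 2 = 2 * (n + 1) by ring, pow_mul, auxI_lam σ2 h2]
  have e4 : Complex.I ^ (3 * lam σ1) * (Complex.I ^ lam σ1) ^ (2 * k.1 + 1) = (σ1 : ℂ) ^ k.1 := by
    rw [mul_comm 3, pow_mul, ← pow_add, show 3 + (2 * k.1 + 1) = 2 * (k.1 + 2) by ring, pow_mul,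
      auxI_lam σ1 h1, pow_add]
    rcases h1 with rfl | rfl <;> simp
  have e5 : (σ2 : ℂ) * (σ2 : ℂ) ^ (n + 1) = (σ2 : ℂ) ^ n := by
    rw [pow_succ]
    rcases h2 with rfl | rfl <;> simp
  have e6 : (2 : ℂ) ^ (p + q - 2) * 4 = 2 ^ p * 2 ^ q := by
    rw [← pow_add, show p + q = p + q - 2 + 2 by omega, pow_add]
    norm_num
  rw [e1, e2, e3]
  have e7 : ((2 * n + 2 : ℕ) : ℂ) = 2 * (n + 1) := by push_cast; ring
  have e8 : ((2 * k.1 + 1 : ℕ) : ℂ) = 2 * (k.1 + 1 / 2) := by push_cast; ring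
  rw [e7, e8, mul_pow, mul_pow]
  have n1 : ((n : ℂ) + 1) ^ q ≠ 0 := pow_ne_zero _ (by exact_mod_cast Nat.succ_ne_zero n)
  have n2 : ((k.1 : ℂ) + 1 / 2) ^ p ≠ 0 := by
    apply pow_ne_zero
    intro h
    have : ((2 * k.1 + 1 : ℕ) : ℂ) = 0 := by rw [e8, h, mul_zero]
    exact Nat.succ_ne_zero _ (Nat.cast_eq_zero.1 this)
  set A := ((n : ℂ) + 1) ^ q
  set B := ((k.1 : ℂ) + 1 / 2) ^ p
  calc (σ2 : ℂ) ^ n * ((σ1 : ℂ) ^ k.1 / B) / A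
      = (2 ^ p * 2 ^ q) * (σ2 ^ n * σ1 ^ k.1) / (2 ^ q * A * (2 ^ p * B)) := by
        field_simp
    _ = _ := by
        rw [← e4, ← e5, ← e6]
        ring
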